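/- arXiv:1509.00229 — 2 statements merged into one kernel-verified Lean document; each statement's English description precedes it below -/
import Mathlib

section
/- Let Ω = ℝ^d/ℤ^d and let h : Ω → ℝ be continuous. The map N_h(μ) = ‖h⋆μ‖_{L²(Ω)} defines a norm on the space M of finite signed Borel measures on Ω if and only if every Fourier coefficient ĥ(ξ) = ∫_Ω e^{−2πi⟨ξ,x⟩} h(x) dx, ξ ∈ ℤ^d, is nonzero. -/
open MeasureTheory Filter Topology
open scoped NNReal ENNReal

noncomputable section

/-- The `d`-dimensional torus `Ω = ℝ^d/ℤ^d`. -/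
abbrev Torus (d : ℕ) : Type := Fin d → AddCircle (1 : ℝ)

/-- Convolution `(h ⋆ μ)(x) = ∫ h(x−y) dμ(y)` of a function with a finite signed
measure, via the Jordan decomposition of `μ`. -/
def convSigned {d : ℕ} (h : Torus d → ℝ) (μ : SignedMeasure (Torus d)) (x : Torus d) : ℝ :=
  ∫ y, h (x - y) ∂μ.toJordanDecomposition.posPart -
    ∫ y, h (x - y) ∂μ.toJordanDecomposition.negPart

/-- `N_h(μ) = ‖h ⋆ μ‖_{L²(Ω)}` for a signed measure `μ`. -/
def nhSigned {d : ℕ} (h : Torus d → ℝ) (μ : SignedMeasure (Torus d)) : ℝ :=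
  Real.sqrt (∫ x, (convSigned h μ x) ^ 2)

/-- The total variation norm `‖μ‖_TV` of a signed measure. -/
def tvNorm {d : ℕ} (μ : SignedMeasure (Torus d)) : ℝ := (μ.totalVariation Set.univ).toReal

/-- The integral `∫ f dμ` of a function against a signed measure. -/
def signedIntegral {d : ℕ} (μ : SignedMeasure (Torus d)) (f : Torus d → ℝ) : ℝ :=
  ∫ y, f y ∂μ.toJordanDecomposition.posPart - ∫ y, f y ∂μ.toJordanDecomposition.negPart

/-- The Fourier coefficient `ĥ(ξ) = ∫_Ω e^{−2πi⟨ξ,x⟩} h(x) dx`, `ξ ∈ ℤ^d`. -/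
def torusFourierCoeff {d : ℕ} (h : Torus d → ℝ) (ξ : Fin d → ℤ) : ℂ :=
  ∫ x : Torus d, (∏ i, fourier (-(ξ i)) (x i)) * (h x : ℂ)

/-- `(h ⋆ (μ − ν))(x)` for two (finite) measures `μ, ν`. -/
def convDiff {d : ℕ} (h : Torus d → ℝ) (μ ν : Measure (Torus d)) (x : Torus d) : ℝ :=
  ∫ y, h (x - y) ∂μ - ∫ y, h (x - y) ∂ν

/-- `N_h(μ − ν) = ‖h ⋆ (μ − ν)‖_{L²(Ω)}`. -/
def nhDist {d : ℕ} (h : Torus d → ℝ) (μ ν : Measure (Torus d)) : ℝ :=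
  Real.sqrt (∫ x, (convDiff h μ ν x) ^ 2)

/-- The L¹ Wasserstein (Kantorovich) distance: infimum of `∫ dist(x,y) dc` over
all couplings `c` of `μ` and `ν`. -/
def W1 {d : ℕ} (μ ν : Measure (Torus d)) : ℝ :=
  sInf { r | ∃ c : Measure (Torus d × Torus d),
    c.map Prod.fst = μ ∧ c.map Prod.snd = ν ∧ r = ∫ p, dist p.1 p.2 ∂c }

/-- The set `𝓜(Ω^N)` of `N`-point measures `(1/N) ∑ δ_{p_i}`. -/
def nPointMeasures (d N : ℕ) : Set (Measure (Torus d)) :=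
  { μ | ∃ p : Fin N → Torus d, μ = (N : ℝ≥0∞)⁻¹ • ∑ i, Measure.dirac (p i) }

/-- Hausdorff distance between two sets of measures with respect to the metric
`(μ, ν) ↦ N_h(μ − ν)`. -/
def hausNh {d : ℕ} (h : Torus d → ℝ) (A B : Set (Measure (Torus d))) : ℝ :=
  max (sSup ((fun μ => sInf ((fun ν => nhDist h μ ν) '' B)) '' A))
      (sSup ((fun ν => sInf ((fun μ => nhDist h μ ν) '' A)) '' B))

lemma Continuous.integrable_of_compactSpace {α E : Type*} [TopologicalSpace α] [CompactSpace α]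
    [MeasurableSpace α] [OpensMeasurableSpace α] [NormedAddCommGroup E]
    [SecondCountableTopologyEither α E] {f : α → E} (hf : Continuous f)
    (p : Measure α) [IsFiniteMeasure p] : Integrable f p := by
  refine ⟨hf.aestronglyMeasurable, HasFiniteIntegral.of_bounded (C := ‖ContinuousMap.mk f hf‖) ?_⟩
  exact Eventually.of_forall fun x => (ContinuousMap.mk f hf).norm_coe_le_norm x

/-- The integral against the Jordan decomposition of `p - q` is the difference of integrals. -/
lemma integral_posPart_sub_integral_negPart {α E : Type*} [TopologicalSpace α] [CompactSpace α]
    [MeasurableSpace α] [OpensMeasurableSpace α] [NormedAddCommGroup E] [NormedSpace ℝ E]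
    [SecondCountableTopologyEither α E] {f : α → E} (hf : Continuous f)
    {μ : SignedMeasure α} (p q : Measure α) [IsFiniteMeasure p] [IsFiniteMeasure q]
    (hμ : μ = p.toSignedMeasure - q.toSignedMeasure) :
    ∫ y, f y ∂μ.toJordanDecomposition.posPart - ∫ y, f y ∂μ.toJordanDecomposition.negPart =
      ∫ y, f y ∂p - ∫ y, f y ∂q := by
  have hadd : μ.toJordanDecomposition.posPart + q = p + μ.toJordanDecomposition.negPart := by
    rw [← Measure.toSignedMeasure_eq_toSignedMeasure_iff, Measure.toSignedMeasure_add,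
      Measure.toSignedMeasure_add]
    rw [← μ.toSignedMeasure_toJordanDecomposition, JordanDecomposition.toSignedMeasure,
      sub_eq_sub_iff_add_eq_add] at hμ
    exact hμ
  have key := congrArg (fun ρ => ∫ y, f y ∂ρ) hadd
  rw [integral_add_measure (hf.integrable_of_compactSpace _) (hf.integrable_of_compactSpace _),
    integral_add_measure (hf.integrable_of_compactSpace _)
      (hf.integrable_of_compactSpace _)] at key
  exact sub_eq_sub_iff_add_eq_add.2 key

section Convolution

variable {d : ℕ} (h : C(Torus d, ℝ))

lemma continuous_convSigned (μ : SignedMeasure (Torus d)) : Continuous (convSigned h μ) := by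
  have hint (p : Measure (Torus d)) [IsFiniteMeasure p] :
      Continuous fun x => ∫ y, h (x - y) ∂p := by
    refine continuous_of_dominated (bound := fun _ => ‖h‖) (fun x => ?_) (fun x => ?_)
      (integrable_const _) ?_
    · exact Continuous.aestronglyMeasurable (by fun_prop)
    · exact Eventually.of_forall fun y => h.norm_coe_le_norm _
    · exact Eventually.of_forall fun y => by fun_prop
  exact (hint _).sub (hint _)

/-- The convolution `h ⋆ μ` as a continuous function. -/
def convSignedMap (μ : SignedMeasure (Torus d)) : C(Torus d, ℝ) :=
  ⟨convSigned h μ, continuous_convSigned h μ⟩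

lemma convSignedMap_add (μ ν : SignedMeasure (Torus d)) :
    convSignedMap h (μ + ν) = convSignedMap h μ + convSignedMap h ν := by
  ext x
  have hf : Continuous fun y => h (x - y) := by fun_prop
  change convSigned h (μ + ν) x = convSigned h μ x + convSigned h ν x
  unfold convSigned
  rw [integral_posPart_sub_integral_negPart hf
      (μ.toJordanDecomposition.posPart + ν.toJordanDecomposition.posPart)
      (μ.toJordanDecomposition.negPart + ν.toJordanDecomposition.negPart),
    integral_add_measure (hf.integrable_of_compactSpace _) (hf.integrable_of_compactSpace _),
    integral_add_measure (hf.integrable_of_compactSpace _) (hf.integrable_of_compactSpace _)]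
  · ring
  · nth_rewrite 1 [← μ.toSignedMeasure_toJordanDecomposition,
      ← ν.toSignedMeasure_toJordanDecomposition]
    simp only [JordanDecomposition.toSignedMeasure, Measure.toSignedMeasure_add]
    abel

lemma convSignedMap_smul (r : ℝ) (μ : SignedMeasure (Torus d)) :
    convSignedMap h (r • μ) = r • convSignedMap h μ := by
  ext x
  change convSigned h (r • μ) x = r • convSigned h μ x
  unfold convSigned
  rw [SignedMeasure.toJordanDecomposition_smul_real]
  rcases le_or_gt 0 r with hr | hr
  · rw [JordanDecomposition.real_smul_posPart_nonneg _ _ hr,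
      JordanDecomposition.real_smul_negPart_nonneg _ _ hr, integral_smul_nnreal_measure,
      integral_smul_nnreal_measure]
    simp only [NNReal.smul_def, Real.coe_toNNReal r hr, smul_eq_mul]
    ring
  · rw [JordanDecomposition.real_smul_posPart_neg _ _ hr,
      JordanDecomposition.real_smul_negPart_neg _ _ hr, integral_smul_nnreal_measure,
      integral_smul_nnreal_measure]
    simp only [NNReal.smul_def, Real.coe_toNNReal (-r) (by linarith), smul_eq_mul]
    ring

lemma nhSigned_eq_norm_toLp (μ : SignedMeasure (Torus d)) :
    nhSigned h μ = ‖ContinuousMap.toLp 2 volume ℝ (convSignedMap h μ)‖ := by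
  rw [nhSigned, norm_eq_sqrt_real_inner, ContinuousMap.inner_toLp]
  congr 1
  refine integral_congr_ae (Eventually.of_forall fun x => ?_)
  simp [convSignedMap, sq]

lemma nhSigned_eq_zero_iff (μ : SignedMeasure (Torus d)) :
    nhSigned h μ = 0 ↔ convSignedMap h μ = 0 := by
  rw [nhSigned_eq_norm_toLp, norm_eq_zero]
  exact map_eq_zero_iff _ (ContinuousMap.toLp_injective (𝕜 := ℝ) volume)

end Convolution

section Fourier

open UnitAddTorus

variable {d : ℕ}

lemma mFourier_apply_add (n : Fin d → ℤ) (x y : Torus d) :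
    mFourier n (x + y) = mFourier n x * mFourier n y := by
  simp [mFourier, fourier_apply, smul_add, AddCircle.toCircle_add, Finset.prod_mul_distrib]

lemma mFourier_apply_neg (n : Fin d → ℤ) (x : Torus d) :
    mFourier n (-x) = mFourier (-n) x := by
  simp [mFourier, fourier_apply]

lemma torusFourierCoeff_eq (h : Torus d → ℝ) (ξ : Fin d → ℤ) :
    torusFourierCoeff h ξ = ∫ x : Torus d, mFourier (-ξ) x * (h x : ℂ) := rfl

/-- The Fourier transform turns convolution with a finite measure into multiplication. -/
lemma integral_mFourier_mul_conv (h : C(Torus d, ℝ)) (ξ : Fin d → ℤ) (p : Measure (Torus d))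
    [IsFiniteMeasure p] :
    ∫ x : Torus d, mFourier (-ξ) x * ((∫ y, h (x - y) ∂p : ℝ) : ℂ) =
      torusFourierCoeff h ξ * ∫ y, mFourier (-ξ) y ∂p := by
  have hcont : Continuous (Function.uncurry fun x y : Torus d =>
      mFourier (-ξ) x * (h (x - y) : ℂ)) := by
    unfold Function.uncurry; fun_prop
  calc ∫ x : Torus d, mFourier (-ξ) x * ((∫ y, h (x - y) ∂p : ℝ) : ℂ)
      = ∫ x : Torus d, ∫ y, mFourier (-ξ) x * (h (x - y) : ℂ) ∂p := by
        simp_rw [← integral_complex_ofReal, integral_const_mul]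
    _ = ∫ y, (∫ x : Torus d, mFourier (-ξ) x * (h (x - y) : ℂ)) ∂p :=
        integral_integral_swap (hcont.integrable_of_compactSpace _)
    _ = ∫ y, torusFourierCoeff h ξ * mFourier (-ξ) y ∂p := by
        refine integral_congr_ae (Eventually.of_forall fun y => ?_)
        change ∫ x : Torus d, mFourier (-ξ) x * (h (x - y) : ℂ) = torusFourierCoeff h ξ * _
        rw [← integral_add_right_eq_self _ y, torusFourierCoeff_eq, ← integral_mul_const]
        refine integral_congr_ae (Eventually.of_forall fun x => ?_)
        simp only [mFourier_apply_add, add_sub_cancel_right]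
        ring
    _ = _ := integral_const_mul _ _

/-- A finite measure on the torus is determined by its Fourier–Stieltjes coefficients. -/
lemma ext_of_integral_mFourier {p q : Measure (Torus d)} [IsFiniteMeasure p] [IsFiniteMeasure q]
    (hpq : ∀ n : Fin d → ℤ, ∫ y, mFourier n y ∂p = ∫ y, mFourier n y ∂q) : p = q := by
  let L (ρ : Measure (Torus d)) [IsFiniteMeasure ρ] : C(Torus d, ℂ) →L[ℂ] ℂ :=
    LinearMap.mkContinuous
      { toFun := fun f => ∫ y, f y ∂ρ
        map_add' := fun f g => integral_add (f.continuous.integrable_of_compactSpace _)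
          (g.continuous.integrable_of_compactSpace _)
        map_smul' := fun c f => integral_const_mul _ _ } (ρ.real Set.univ) fun f => by
      rw [mul_comm]
      exact norm_integral_le_of_norm_le_const (Eventually.of_forall f.norm_coe_le_norm)
  have hL : L p = L q := by
    refine ContinuousLinearMap.ext_on (s := Set.range mFourier) ?_ ?_
    · exact Submodule.dense_iff_topologicalClosure_eq_top.2 span_mFourier_closure_eq_top
    · rintro _ ⟨n, rfl⟩
      exact hpq n
  refine ext_of_forall_integral_eq_of_IsFiniteMeasure fun f => ?_
  have := DFunLike.congr_fun hL ⟨fun x => (f x : ℂ), by fun_prop⟩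
  change ∫ y, (f y : ℂ) ∂p = ∫ y, (f y : ℂ) ∂q at this
  rw [integral_complex_ofReal, integral_complex_ofReal] at this
  exact_mod_cast this

lemma eq_zero_of_convSignedMap_eq_zero {h : C(Torus d, ℝ)}
    (hh : ∀ ξ, torusFourierCoeff h ξ ≠ 0) {μ : SignedMeasure (Torus d)}
    (hμ : convSignedMap h μ = 0) : μ = 0 := by
  rw [← μ.toSignedMeasure_toJordanDecomposition, JordanDecomposition.toSignedMeasure, sub_eq_zero,
    Measure.toSignedMeasure_eq_toSignedMeasure_iff]
  refine ext_of_integral_mFourier fun n => ?_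
  have hconv : ∀ x, ∫ y, h (x - y) ∂μ.toJordanDecomposition.posPart =
      ∫ y, h (x - y) ∂μ.toJordanDecomposition.negPart := fun x =>
    sub_eq_zero.1 (DFunLike.congr_fun hμ x)
  have h₁ := integral_mFourier_mul_conv h (-n) μ.toJordanDecomposition.posPart
  have h₂ := integral_mFourier_mul_conv h (-n) μ.toJordanDecomposition.negPart
  simp_rw [hconv] at h₁
  rw [neg_neg] at h₁ h₂
  exact mul_left_cancel₀ (hh (-n)) (h₁.symm.trans h₂)

lemma convSigned_withDensityᵥ (h : C(Torus d, ℝ)) {g : Torus d → ℝ} (hg : Continuous g)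
    (x : Torus d) :
    convSigned h ((volume : Measure (Torus d)).withDensityᵥ g) x = ∫ y, g y * h (x - y) := by
  have hgi := hg.integrable_of_compactSpace (volume : Measure (Torus d))
  have hgn := hgi.neg
  have := isFiniteMeasure_withDensity_ofReal hgi.2
  have := isFiniteMeasure_withDensity_ofReal hgn.2
  unfold convSigned
  rw [integral_posPart_sub_integral_negPart (by fun_prop) _ _
      (withDensityᵥ_eq_withDensity_pos_part_sub_withDensity_neg_part hgi),
    integral_withDensity_eq_integral_toReal_smul (by fun_prop) (by simp),
    integral_withDensity_eq_integral_toReal_smul (by fun_prop) (by simp), ← integral_sub]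
  · refine integral_congr_ae (Eventually.of_forall fun y => ?_)
    simp only [ENNReal.toReal_ofReal', smul_eq_mul, ← sub_mul, max_zero_sub_max_neg_zero_eq_self]
  all_goals
    simp only [ENNReal.toReal_ofReal']
    exact Continuous.integrable_of_compactSpace (by fun_prop) _

/-- If `ĥ(ξ) = 0` then convolution with `h` annihilates the measure with density
`cos (2π⟨ξ, x⟩)`. -/
lemma exists_ne_zero_convSignedMap_eq_zero {h : C(Torus d, ℝ)} {ξ : Fin d → ℤ}
    (hξ : torusFourierCoeff h ξ = 0) :
    ∃ μ : SignedMeasure (Torus d), μ ≠ 0 ∧ convSignedMap h μ = 0 := by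
  have hg : Continuous fun y : Torus d => (mFourier ξ y).re := by fun_prop
  refine ⟨(volume : Measure (Torus d)).withDensityᵥ fun y => (mFourier ξ y).re, fun h0 => ?_, ?_⟩
  · rw [← withDensityᵥ_zero (μ := (volume : Measure (Torus d)))] at h0
    have hae := (hg.integrable_of_compactSpace _).ae_eq_of_withDensityᵥ_eq
      (integrable_zero _ _ _) h0
    have := congrFun (Measure.eq_of_ae_eq hae hg continuous_zero) 0
    simp [mFourier] at this
  · ext x
    change convSigned h _ x = 0
    have : (volume : Measure (Torus d)).IsNegInvariant :=
      Measure.IsAddHaarMeasure.isNegInvariant_of_regular _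
    rw [convSigned_withDensityᵥ h hg, ← integral_sub_left_eq_self _ _ x]
    calc ∫ y, (mFourier ξ (x - y)).re * h (x - (x - y))
        = ∫ y, (mFourier ξ x * (mFourier (-ξ) y * (h y : ℂ))).re := by
          refine integral_congr_ae (Eventually.of_forall fun y => ?_)
          simp only [sub_eq_add_neg x y, mFourier_apply_add, mFourier_apply_neg, ← mul_assoc,
            Complex.re_mul_ofReal]
          simp
      _ = (∫ y, mFourier ξ x * (mFourier (-ξ) y * (h y : ℂ))).re :=
          integral_re (𝕜 := ℂ) (Continuous.integrable_of_compactSpace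
            (f := fun y : Torus d => mFourier ξ x * (mFourier (-ξ) y * (h y : ℂ)))
            (by fun_prop) _)
      _ = 0 := by
          rw [integral_const_mul, ← torusFourierCoeff_eq, hξ, mul_zero, Complex.zero_re]

end Fourier

/-- `N_h` defines a norm on the space of finite signed measures on the
torus if and only if all the Fourier coefficients `ĥ(ξ)`, `ξ ∈ ℤ^d`, are nonzero. -/
theorem nh_is_norm_iff_fourierCoeff_ne_zero {d : ℕ} (h : C(Torus d, ℝ)) :
    ((∀ μ : SignedMeasure (Torus d), nhSigned (⇑h) μ = 0 ↔ μ = 0) ∧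
      (∀ (r : ℝ) (μ : SignedMeasure (Torus d)),
         nhSigned (⇑h) (r • μ) = |r| * nhSigned (⇑h) μ) ∧
      (∀ μ ν : SignedMeasure (Torus d),
         nhSigned (⇑h) (μ + ν) ≤ nhSigned (⇑h) μ + nhSigned (⇑h) ν)) ↔
    (∀ ξ : Fin d → ℤ, torusFourierCoeff (⇑h) ξ ≠ 0) := by
  constructor
  · rintro ⟨hzero, -, -⟩ ξ hξ
    obtain ⟨μ, hμ, hconv⟩ := exists_ne_zero_convSignedMap_eq_zero hξ
    exact hμ ((hzero μ).1 ((nhSigned_eq_zero_iff h μ).2 hconv))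
  · intro hh
    refine ⟨fun μ => ?_, fun r μ => ?_, fun μ ν => ?_⟩
    · rw [nhSigned_eq_zero_iff]
      refine ⟨eq_zero_of_convSignedMap_eq_zero hh, ?_⟩
      rintro rfl
      simpa using convSignedMap_smul h 0 0
    · simp only [nhSigned_eq_norm_toLp, convSignedMap_smul, map_smul, norm_smul, Real.norm_eq_abs]
    · simp only [nhSigned_eq_norm_toLp, convSignedMap_add, map_add]
      exact norm_add_le _ _
end
end

section
/- Let Ω = ℝ^d/ℤ^d, let h ∈ C(Ω) with ĥ(ξ) ≠ 0 for all ξ, let π be a Borel probability measure on Ω, and let 𝓜_N be a TV-bounded weakly closed set of Borel probability measures. For each n let 𝓐_n be a TV-bounded weakly closed set of Borel probability measures with lim_{n→∞} 𝓗_{N_h}(𝓐_n, 𝓜_N) = 0, and let μ*_n minimize N_h(π − μ) over 𝓐_n. Then (μ*_n) has a subsequence converging weakly to a measure μ*_N ∈ 𝓜_N that minimizes N_h(π − μ) over 𝓜_N. -/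
open MeasureTheory Filter Topology
open scoped NNReal ENNReal

noncomputable section

open UnitAddTorus in
/-- Finite measures on the torus with the same Fourier coefficients are equal. -/
theorem Torus.measure_ext_of_integral_mFourier {d : ℕ} {μ ν : Measure (Torus d)}
    [IsFiniteMeasure μ] [IsFiniteMeasure ν]
    (hμν : ∀ n : Fin d → ℤ, ∫ x, mFourier n x ∂μ = ∫ x, mFourier n x ∂ν) : μ = ν := by
  have hint : ∀ (ρ : Measure (Torus d)) [IsFiniteMeasure ρ] (f : C(Torus d, ℂ)),
      Integrable (fun x => f x) ρ := fun ρ _ f =>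
    f.continuous.integrable_of_hasCompactSupport (HasCompactSupport.of_compactSpace _)
  refine ext_of_forall_mem_subalgebra_integral_eq_of_polish (𝕜 := ℂ)
    (A := (mFourierSubalgebra (Fin d)).comap
      (BoundedContinuousFunction.toContinuousMapStarₐ ℂ)) ?_ ?_
  · intro x y hxy
    obtain ⟨_, ⟨f, hf, rfl⟩, hfxy⟩ := mFourierSubalgebra_separatesPoints hxy
    exact ⟨_, ⟨f, ⟨BoundedContinuousFunction.mkOfCompact f, hf, rfl⟩, rfl⟩, hfxy⟩
  · intro g hg
    have hspan : g.toContinuousMap ∈ Submodule.span ℂ (Set.range (mFourier (d := Fin d))) := by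
      rw [← mFourierSubalgebra_coe]
      exact hg
    have key : ∀ f ∈ Submodule.span ℂ (Set.range (mFourier (d := Fin d))),
        ∫ x, f x ∂μ = ∫ x, f x ∂ν := by
      intro f hf
      induction hf using Submodule.span_induction with
      | mem f hf =>
        obtain ⟨n, rfl⟩ := hf
        exact hμν n
      | zero => simp
      | add f₁ f₂ _ _ h₁ h₂ =>
        simp only [ContinuousMap.add_apply]
        rw [integral_add (hint μ f₁) (hint μ f₂), integral_add (hint ν f₁) (hint ν f₂), h₁, h₂]
      | smul c f _ h =>
        simp only [ContinuousMap.smul_apply]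
        rw [integral_smul, integral_smul, h]
    exact key _ hspan

theorem integrable_translate {d : ℕ} (h : C(Torus d, ℝ)) (μ : Measure (Torus d))
    [IsFiniteMeasure μ] (x : Torus d) : Integrable (fun y => h (x - y)) μ :=
  Continuous.integrable_of_hasCompactSupport (by fun_prop) (HasCompactSupport.of_compactSpace _)

theorem continuous_integral_translate {d : ℕ} (h : C(Torus d, ℝ)) (μ : Measure (Torus d))
    [IsFiniteMeasure μ] : Continuous fun x => ∫ y, h (x - y) ∂μ :=
  continuous_of_dominated (bound := fun _ => ‖h‖)
    (fun x => (integrable_translate h μ x).aestronglyMeasurable)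
    (fun x => ae_of_all _ fun y => h.norm_coe_le_norm _) (integrable_const _)
    (ae_of_all _ fun y => by fun_prop)

theorem continuous_convDiff {d : ℕ} (h : C(Torus d, ℝ)) (μ ν : Measure (Torus d))
    [IsFiniteMeasure μ] [IsFiniteMeasure ν] : Continuous (convDiff h μ ν) :=
  (continuous_integral_translate h μ).sub (continuous_integral_translate h ν)

theorem abs_convDiff_le {d : ℕ} (h : C(Torus d, ℝ)) (μ ν : Measure (Torus d))
    [IsProbabilityMeasure μ] [IsProbabilityMeasure ν] (x : Torus d) :
    |convDiff h μ ν x| ≤ ‖h‖ + ‖h‖ := by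
  have hb : ∀ (ρ : Measure (Torus d)) [IsProbabilityMeasure ρ], ‖∫ y, h (x - y) ∂ρ‖ ≤ ‖h‖ := by
    intro ρ _
    simpa using norm_integral_le_of_norm_le_const (μ := ρ)
      (ae_of_all _ fun y => h.norm_coe_le_norm (x - y))
  exact (norm_sub_le _ _).trans (add_le_add (hb μ) (hb ν))

/-- `N_h` is jointly continuous for weak convergence of probability measures. -/
theorem tendsto_nhDist {d : ℕ} (h : C(Torus d, ℝ)) {ι : Type*} {l : Filter ι}
    [l.IsCountablyGenerated] {α β : ι → ProbabilityMeasure (Torus d)}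
    {α₀ β₀ : ProbabilityMeasure (Torus d)} (hα : Tendsto α l (𝓝 α₀)) (hβ : Tendsto β l (𝓝 β₀)) :
    Tendsto (fun i => nhDist h (α i : Measure (Torus d)) (β i : Measure (Torus d))) l
      (𝓝 (nhDist h (α₀ : Measure (Torus d)) (β₀ : Measure (Torus d)))) := by
  have hw : ∀ {ρ : ι → ProbabilityMeasure (Torus d)} {ρ₀ : ProbabilityMeasure (Torus d)},
      Tendsto ρ l (𝓝 ρ₀) → ∀ x : Torus d,
      Tendsto (fun i => ∫ y, h (x - y) ∂(ρ i : Measure (Torus d))) l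
        (𝓝 (∫ y, h (x - y) ∂(ρ₀ : Measure (Torus d)))) := fun hρ x =>
    ProbabilityMeasure.tendsto_iff_forall_integral_tendsto.1 hρ
      (BoundedContinuousFunction.mkOfCompact ⟨fun y => h (x - y), by fun_prop⟩)
  refine (Real.continuous_sqrt.tendsto _).comp ?_
  refine tendsto_integral_filter_of_dominated_convergence (fun _ => (‖h‖ + ‖h‖) ^ 2)
    (Eventually.of_forall fun i => ((continuous_convDiff h _ _).pow 2).aestronglyMeasurable)
    (Eventually.of_forall fun i => ae_of_all _ fun x => ?_) (integrable_const _)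
    (ae_of_all _ fun x => ((hw hα x).sub (hw hβ x)).pow 2)
  rw [norm_pow]
  exact pow_le_pow_left₀ (norm_nonneg _) (abs_convDiff_le h _ _ x) 2

/-- The Fourier coefficients of `h ⋆ μ` are the products of those of `h` and of `μ`. -/
theorem integral_mFourier_mul_integral_translate {d : ℕ} (h : C(Torus d, ℝ))
    (μ : Measure (Torus d)) [IsFiniteMeasure μ] (n : Fin d → ℤ) :
    ∫ x, UnitAddTorus.mFourier (-n) x * ((∫ y, h (x - y) ∂μ : ℝ) : ℂ) =
      torusFourierCoeff h n * ∫ y, UnitAddTorus.mFourier (-n) y ∂μ := by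
  have hadd : ∀ x y : Torus d, UnitAddTorus.mFourier (-n) (x + y) =
      UnitAddTorus.mFourier (-n) x * UnitAddTorus.mFourier (-n) y := by
    intro x y
    simp [UnitAddTorus.mFourier, fourier_apply, smul_add, AddCircle.toCircle_add,
      Finset.prod_mul_distrib]
  calc ∫ x, UnitAddTorus.mFourier (-n) x * ((∫ y, h (x - y) ∂μ : ℝ) : ℂ)
      = ∫ x, ∫ y, UnitAddTorus.mFourier (-n) x * (h (x - y) : ℂ) ∂μ := by
        refine integral_congr_ae (ae_of_all _ fun x => ?_)
        simp only [integral_const_mul, integral_complex_ofReal]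
    _ = ∫ y, (∫ x, UnitAddTorus.mFourier (-n) x * (h (x - y) : ℂ)) ∂μ := by
        refine integral_integral_swap_of_hasCompactSupport ?_ (HasCompactSupport.of_compactSpace _)
        simp only [Function.uncurry_def]
        fun_prop
    _ = ∫ y, torusFourierCoeff h n * UnitAddTorus.mFourier (-n) y ∂μ := by
        refine integral_congr_ae (ae_of_all _ fun y => ?_)
        dsimp only
        rw [← integral_add_right_eq_self _ y, torusFourierCoeff, ← integral_mul_const]
        refine integral_congr_ae (ae_of_all _ fun x => ?_)
        dsimp only
        rw [hadd, add_sub_cancel_right]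
        simp only [UnitAddTorus.mFourier, ContinuousMap.coe_mk, Pi.neg_apply]
        ring
    _ = _ := integral_const_mul _ _

/-- If no Fourier coefficient of `h` vanishes, then `N_h` separates finite measures. -/
theorem eq_of_nhDist_eq_zero {d : ℕ} (h : C(Torus d, ℝ))
    (hfc : ∀ ξ : Fin d → ℤ, torusFourierCoeff h ξ ≠ 0) {μ ν : Measure (Torus d)}
    [IsFiniteMeasure μ] [IsFiniteMeasure ν] (hμν : nhDist h μ ν = 0) : μ = ν := by
  have hcont := continuous_convDiff h μ ν
  have hnonneg : 0 ≤ fun x => convDiff h μ ν x ^ 2 := fun x => sq_nonneg _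
  have hsq : ∫ x, convDiff h μ ν x ^ 2 = 0 :=
    (Real.sqrt_eq_zero (integral_nonneg hnonneg)).1 hμν
  have hzero : (fun x => convDiff h μ ν x ^ 2) = 0 := by
    by_contra hne
    obtain ⟨x, hx⟩ := Function.ne_iff.1 hne
    exact ((hcont.pow 2).integral_pos_of_hasCompactSupport_nonneg_nonzero
      (HasCompactSupport.of_compactSpace _) hnonneg hx).ne' hsq
  have heq : ∀ x, ∫ y, h (x - y) ∂μ = ∫ y, h (x - y) ∂ν := fun x =>
    sub_eq_zero.1 (pow_eq_zero_iff two_ne_zero |>.1 (congrFun hzero x))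
  refine Torus.measure_ext_of_integral_mFourier fun n => ?_
  refine mul_left_cancel₀ (hfc (-n)) ?_
  have hμ := integral_mFourier_mul_integral_translate h μ (-n)
  have hν := integral_mFourier_mul_integral_translate h ν (-n)
  rw [neg_neg] at hμ hν
  rw [← hμ, ← hν]
  simp only [heq]

theorem nhDist_le {d : ℕ} (h : C(Torus d, ℝ)) (μ ν : Measure (Torus d))
    [IsProbabilityMeasure μ] [IsProbabilityMeasure ν] : nhDist h μ ν ≤ ‖h‖ + ‖h‖ := by
  refine Real.sqrt_le_iff.2 ⟨by positivity, ?_⟩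
  have := norm_integral_le_of_norm_le_const (μ := (volume : Measure (Torus d)))
    (f := fun x => convDiff h μ ν x ^ 2) (C := (‖h‖ + ‖h‖) ^ 2) (ae_of_all _ fun x => by
      rw [norm_pow]
      exact pow_le_pow_left₀ (norm_nonneg _) (abs_convDiff_le h μ ν x) 2)
  have hvol : (volume : Measure (Torus d)).real Set.univ = 1 := by
    simp [measureReal_def, volume_pi, Measure.pi_univ]
  rw [hvol, mul_one] at this
  exact (le_abs_self _).trans this

/-- Nonnegative real functions: an infimum below a supremum of infima is almost attained. -/
theorem exists_lt_sSup_sInf_add {α β : Type*} {f : α → β → ℝ} {A : Set α} {B : Set β} {C : ℝ}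
    (h0 : ∀ a b, 0 ≤ f a b) (hC : ∀ a ∈ A, ∀ b ∈ B, f a b ≤ C) (hB : B.Nonempty) {a : α}
    (ha : a ∈ A) {ε : ℝ} (hε : 0 < ε) :
    ∃ b ∈ B, f a b < sSup ((fun a => sInf (f a '' B)) '' A) + ε := by
  have hbdd : BddAbove ((fun a => sInf (f a '' B)) '' A) := by
    refine ⟨C, ?_⟩
    rintro _ ⟨a, ha, rfl⟩
    obtain ⟨b, hb⟩ := hB
    refine (csInf_le ⟨0, ?_⟩ (Set.mem_image_of_mem _ hb)).trans (hC a ha b hb)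
    rintro _ ⟨b, -, rfl⟩
    exact h0 a b
  have hlt : sInf (f a '' B) < sSup ((fun a => sInf (f a '' B)) '' A) + ε :=
    (le_csSup hbdd (Set.mem_image_of_mem _ ha)).trans_lt (lt_add_of_pos_right _ hε)
  obtain ⟨_, ⟨b, hb, rfl⟩, hlt⟩ := exists_lt_of_csInf_lt (hB.image _) hlt
  exact ⟨b, hb, hlt⟩

theorem exists_nhDist_lt_hausNh_add {d : ℕ} (h : C(Torus d, ℝ))
    {A B : Set (ProbabilityMeasure (Torus d))} (hB : B.Nonempty)
    {μ : ProbabilityMeasure (Torus d)} (hμ : μ ∈ A) {ε : ℝ} (hε : 0 < ε) :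
    ∃ ν ∈ B, nhDist h (μ : Measure (Torus d)) (ν : Measure (Torus d)) <
      hausNh h ((fun μ : ProbabilityMeasure (Torus d) => (μ : Measure (Torus d))) '' A)
        ((fun μ : ProbabilityMeasure (Torus d) => (μ : Measure (Torus d))) '' B) + ε := by
  obtain ⟨_, ⟨ν, hν, rfl⟩, hlt⟩ := exists_lt_sSup_sInf_add (f := fun μ ν => nhDist h μ ν)
    (A := (fun μ : ProbabilityMeasure (Torus d) => (μ : Measure (Torus d))) '' A)
    (B := (fun μ : ProbabilityMeasure (Torus d) => (μ : Measure (Torus d))) '' B)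
    (C := ‖h‖ + ‖h‖) (fun _ _ => Real.sqrt_nonneg _)
    (by rintro _ ⟨μ, -, rfl⟩ _ ⟨ν, -, rfl⟩; exact nhDist_le h _ _) (hB.image _)
    (Set.mem_image_of_mem _ hμ) hε
  exact ⟨ν, hν, hlt.trans_le (add_le_add (le_max_left _ _) le_rfl)⟩

theorem hausNh_comm {d : ℕ} (h : Torus d → ℝ) (A B : Set (Measure (Torus d))) :
    hausNh h A B = hausNh h B A := by
  have hsymm : ∀ μ ν, nhDist h μ ν = nhDist h ν μ := by
    intro μ ν
    unfold nhDist convDiff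
    simp only [sub_sq_comm]
  unfold hausNh
  rw [max_comm]
  simp only [hsymm]

/-- If `K` is closed, `α n` approaches `K` in `N_h` and converges weakly, the limit is in `K`. -/
theorem mem_of_tendsto_of_tendsto_nhDist {d : ℕ} (h : C(Torus d, ℝ))
    (hfc : ∀ ξ : Fin d → ℤ, torusFourierCoeff h ξ ≠ 0)
    {K : Set (ProbabilityMeasure (Torus d))} (hK : IsClosed K)
    {α β : ℕ → ProbabilityMeasure (Torus d)} (hβ : ∀ n, β n ∈ K)
    (hαβ : Tendsto (fun n => nhDist h (α n : Measure (Torus d)) (β n : Measure (Torus d)))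
      atTop (𝓝 0))
    {α₀ : ProbabilityMeasure (Torus d)} (hα : Tendsto α atTop (𝓝 α₀)) : α₀ ∈ K := by
  obtain ⟨β₀, hβ₀, ψ, hψ, hlim⟩ := hK.isCompact.tendsto_subseq hβ
  have hzero := tendsto_nhds_unique (tendsto_nhDist h (hα.comp hψ.tendsto_atTop) hlim)
    (hαβ.comp hψ.tendsto_atTop)
  have heq : α₀ = β₀ := ProbabilityMeasure.toMeasure_injective (eq_of_nhDist_eq_zero h hfc hzero)
  exact heq ▸ hβ₀

/-- If `𝓗_{N_h}(𝓐_n, 𝓜_N) → 0` and `μ*_n` minimizes `N_h(π − ·)` over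
`𝓐_n`, then a subsequence of `(μ*_n)` converges weakly to a minimizer of `N_h(π − ·)` over
`𝓜_N`. -/
theorem subsequence_tendsto_projection_of_hausdorff_tendsto_zero {d : ℕ}
    (h : C(Torus d, ℝ)) (hfc : ∀ ξ : Fin d → ℤ, torusFourierCoeff (⇑h) ξ ≠ 0)
    (π : Measure (Torus d)) [IsProbabilityMeasure π]
    (𝓜 : Set (ProbabilityMeasure (Torus d))) (h𝓜closed : IsClosed 𝓜) (h𝓜ne : 𝓜.Nonempty)
    (𝓐 : ℕ → Set (ProbabilityMeasure (Torus d))) (h𝓐closed : ∀ n, IsClosed (𝓐 n))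
    (hHaus : Tendsto (fun n =>
        hausNh (⇑h) ((fun μ : ProbabilityMeasure (Torus d) => (μ : Measure (Torus d))) '' 𝓐 n)
          ((fun μ : ProbabilityMeasure (Torus d) => (μ : Measure (Torus d))) '' 𝓜))
      atTop (𝓝 0))
    (μs : ℕ → ProbabilityMeasure (Torus d)) (hmem : ∀ n, μs n ∈ 𝓐 n)
    (hmin : ∀ n, ∀ μ ∈ 𝓐 n,
      nhDist (⇑h) π (μs n : Measure (Torus d)) ≤ nhDist (⇑h) π (μ : Measure (Torus d))) :
    ∃ φ : ℕ → ℕ, StrictMono φ ∧ ∃ μN ∈ 𝓜,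
      Tendsto (fun k => μs (φ k)) atTop (𝓝 μN) ∧
        ∀ μ ∈ 𝓜, nhDist (⇑h) π (μN : Measure (Torus d)) ≤
          nhDist (⇑h) π (μ : Measure (Torus d)) := by
  set H : ℕ → ℝ := fun n =>
    hausNh (⇑h) ((fun μ : ProbabilityMeasure (Torus d) => (μ : Measure (Torus d))) '' 𝓐 n)
      ((fun μ : ProbabilityMeasure (Torus d) => (μ : Measure (Torus d))) '' 𝓜) with hH
  have hbound : Tendsto (fun n : ℕ => H n + 1 / ((n : ℝ) + 1)) atTop (𝓝 0) := by
    simpa using hHaus.add tendsto_one_div_add_atTop_nhds_zero_nat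
  obtain ⟨μN, -, φ, hφ, hlim⟩ := isCompact_univ.tendsto_subseq fun n => Set.mem_univ (μs n)
  refine ⟨φ, hφ, μN, ?_, hlim, fun μ hμ => ?_⟩
  · choose β hβ hlt using fun n : ℕ =>
      exists_nhDist_lt_hausNh_add h h𝓜ne (hmem n) (Nat.one_div_pos_of_nat (α := ℝ) (n := n))
    refine mem_of_tendsto_of_tendsto_nhDist h hfc h𝓜closed (fun n => hβ (φ n)) ?_ hlim
    exact (squeeze_zero (fun _ => Real.sqrt_nonneg _) (fun n => (hlt n).le) hbound).comp
      hφ.tendsto_atTop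
  · choose β hβ hlt using fun n : ℕ =>
      exists_nhDist_lt_hausNh_add h ⟨_, hmem n⟩ hμ (Nat.one_div_pos_of_nat (α := ℝ) (n := n))
    have hzero : Tendsto (fun n => nhDist h (μ : Measure (Torus d)) (β n : Measure (Torus d)))
        atTop (𝓝 0) := by
      refine squeeze_zero (fun _ => Real.sqrt_nonneg _) (fun n => ?_) hbound
      rw [hH]
      dsimp only
      rw [hausNh_comm]
      exact (hlt n).le
    obtain ⟨β₀, -, ψ, hψ, hβ₀⟩ := isCompact_univ.tendsto_subseq fun n => Set.mem_univ (β (φ n))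
    have hμβ : μ = β₀ := by
      refine ProbabilityMeasure.toMeasure_injective (eq_of_nhDist_eq_zero h hfc ?_)
      exact tendsto_nhds_unique (tendsto_nhDist h (tendsto_const_nhds (x := μ)) hβ₀)
        (hzero.comp (hφ.comp hψ).tendsto_atTop)
    rw [hμβ]
    let πp : ProbabilityMeasure (Torus d) := ⟨π, inferInstance⟩
    have hπ : Tendsto (fun _ : ℕ => πp) atTop (𝓝 πp) := tendsto_const_nhds
    exact le_of_tendsto_of_tendsto' (tendsto_nhDist h hπ (hlim.comp hψ.tendsto_atTop))
      (tendsto_nhDist h hπ hβ₀) fun k => hmin _ _ (hβ _)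
end
end
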